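/- Let Ω ⊂ ℝⁿ be a smooth bounded domain with n ≥ 2, let g be a C^∞ function, and let u, smooth on the closure of Ω, be a semi-stable classical solution of −Δu = g(u) in Ω with u = 0 on ∂Ω. Then for every Lipschitz function η on the closure of Ω with η = 0 on ∂Ω one has (n−1) ∫_{Ω ∩ {|∇u|>0}} H_u² |∇u|² η² dx ≤ ∫_Ω |∇u|² |∇η|² dx. -/

import Mathlib

open MeasureTheory Filter Bornology
open scoped ENNReal Topology

/-- Divergence of a vector field on `ℝⁿ = EuclideanSpace ℝ (Fin n)`. -/
noncomputable def divg {n : ℕ} (V : EuclideanSpace ℝ (Fin n) → EuclideanSpace ℝ (Fin n))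
    (x : EuclideanSpace ℝ (Fin n)) : ℝ :=
  ∑ i, fderiv ℝ V x (EuclideanSpace.single i 1) i

/-- `H_u(x) = -(1/(n-1)) div(∇u/|∇u|)(x)`, the mean curvature of the level set of `|u|`
through `x` (at points where `∇u(x) ≠ 0`). -/
noncomputable def meanCurv {n : ℕ} (u : EuclideanSpace ℝ (Fin n) → ℝ)
    (x : EuclideanSpace ℝ (Fin n)) : ℝ :=
  -(1 / ((n : ℝ) - 1)) * divg (fun y => ‖gradient u y‖⁻¹ • gradient u y) x

/-- The Laplacian `Δu = div ∇u` on `ℝⁿ`. -/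
noncomputable def lap {n : ℕ} (u : EuclideanSpace ℝ (Fin n) → ℝ)
    (x : EuclideanSpace ℝ (Fin n)) : ℝ :=
  divg (gradient u) x

/-- Semi-stability of a solution `u` of `-Δu = g(u)` in `Ω`, `u = 0` on `∂Ω`:
`∫_Ω (|∇ξ|² - g'(u) ξ²) dx ≥ 0` for every `C¹` function `ξ` vanishing on `∂Ω`. -/
def SemiStable {n : ℕ} (Ω : Set (EuclideanSpace ℝ (Fin n))) (g : ℝ → ℝ)
    (u : EuclideanSpace ℝ (Fin n) → ℝ) : Prop :=
  ∀ ξ : EuclideanSpace ℝ (Fin n) → ℝ, ContDiff ℝ 1 ξ → (∀ x ∈ frontier Ω, ξ x = 0) →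
    0 ≤ ∫ x in Ω, (‖gradient ξ x‖ ^ 2 - deriv g (u x) * ξ x ^ 2)

open scoped ContDiff

/-- The partial derivative `∂ᵢ f` of a function on `ℝⁿ`. -/
noncomputable def partialDeriv {n : ℕ} (i : Fin n) (f : EuclideanSpace ℝ (Fin n) → ℝ)
    (x : EuclideanSpace ℝ (Fin n)) : ℝ :=
  fderiv ℝ f x (EuclideanSpace.single i 1)

section PartialDeriv

variable {n : ℕ} {f h : EuclideanSpace ℝ (Fin n) → ℝ} {x : EuclideanSpace ℝ (Fin n)}

lemma gradient_apply_eq_partialDeriv (f : EuclideanSpace ℝ (Fin n) → ℝ)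
    (x : EuclideanSpace ℝ (Fin n)) (i : Fin n) : gradient f x i = partialDeriv i f x := by
  have h : inner ℝ (gradient f x) (EuclideanSpace.single i 1) = partialDeriv i f x := by
    simp [gradient, partialDeriv, InnerProductSpace.toDual_symm_apply]
  rw [← h, EuclideanSpace.inner_single_right]
  simp

lemma norm_gradient_sq (f : EuclideanSpace ℝ (Fin n) → ℝ) (x : EuclideanSpace ℝ (Fin n)) :
    ‖gradient f x‖ ^ 2 = ∑ i, partialDeriv i f x ^ 2 := by
  simp [EuclideanSpace.norm_sq_eq, gradient_apply_eq_partialDeriv]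

lemma norm_gradient_eq_norm_fderiv (f : EuclideanSpace ℝ (Fin n) → ℝ)
    (x : EuclideanSpace ℝ (Fin n)) : ‖gradient f x‖ = ‖fderiv ℝ f x‖ := by
  simp [gradient]

lemma partialDeriv_mul (i : Fin n) (hf : DifferentiableAt ℝ f x) (hh : DifferentiableAt ℝ h x) :
    partialDeriv i (fun y => f y * h y) x
      = f x * partialDeriv i h x + partialDeriv i f x * h x := by
  simp [partialDeriv, fderiv_fun_mul hf hh, mul_comm]

lemma partialDeriv_sum {ι : Type*} (s : Finset ι) {F : ι → EuclideanSpace ℝ (Fin n) → ℝ}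
    (i : Fin n) (hF : ∀ j ∈ s, DifferentiableAt ℝ (F j) x) :
    partialDeriv i (fun y => ∑ j ∈ s, F j y) x = ∑ j ∈ s, partialDeriv i (F j) x := by
  simp [partialDeriv, fderiv_fun_sum hF]

lemma partialDeriv_sq (i : Fin n) (hf : DifferentiableAt ℝ f x) :
    partialDeriv i (fun y => f y ^ 2) x = 2 * (f x * partialDeriv i f x) := by
  simp only [sq]
  rw [partialDeriv_mul i hf hf]
  ring

lemma partialDeriv_comp (i : Fin n) {φ : ℝ → ℝ} (hφ : DifferentiableAt ℝ φ (f x))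
    (hf : DifferentiableAt ℝ f x) :
    partialDeriv i (fun y => φ (f y)) x = deriv φ (f x) * partialDeriv i f x := by
  simpa [partialDeriv, Function.comp_def] using
    congrArg (fun L => L (EuclideanSpace.single i 1))
      (hφ.hasDerivAt.comp_hasFDerivAt x hf.hasFDerivAt).fderiv

lemma ContDiff.partialDeriv {m k : WithTop ℕ∞} (hf : ContDiff ℝ m f) (i : Fin n)
    (hmk : k + 1 ≤ m) : ContDiff ℝ k (partialDeriv i f) :=
  (hf.fderiv_right hmk).clm_apply contDiff_const

lemma ContDiff.partialDeriv_infty (hf : ContDiff ℝ ∞ f) (i : Fin n) :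
    ContDiff ℝ ∞ (_root_.partialDeriv i f) := hf.partialDeriv i le_rfl

lemma partialDeriv_comm (hf : ContDiff ℝ 2 f) (i j : Fin n) :
    partialDeriv i (partialDeriv j f) = partialDeriv j (partialDeriv i f) := by
  ext x
  have hd : DifferentiableAt ℝ (fderiv ℝ f) x :=
    ((hf.fderiv_right (m := 1) le_rfl).differentiable (by simp)) x
  have key : ∀ i j : Fin n, partialDeriv i (partialDeriv j f) x
      = fderiv ℝ (fderiv ℝ f) x (EuclideanSpace.single i 1) (EuclideanSpace.single j 1) := by
    intro i j
    change fderiv ℝ (fun y => fderiv ℝ f y (EuclideanSpace.single j 1)) x _ = _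
    rw [fderiv_clm_apply hd (by fun_prop)]
    simp
  rw [key, key]
  exact (hf.contDiffAt.isSymmSndFDerivAt (by simp)) _ _

lemma divg_eq_sum_partialDeriv {V : EuclideanSpace ℝ (Fin n) → EuclideanSpace ℝ (Fin n)}
    (hV : DifferentiableAt ℝ V x) :
    divg V x = ∑ i, partialDeriv i (fun y => V y i) x := by
  unfold divg partialDeriv
  refine Finset.sum_congr rfl fun i _ => ?_
  have := ((EuclideanSpace.proj i : EuclideanSpace ℝ (Fin n) →L[ℝ] ℝ).hasFDerivAt.comp x
    hV.hasFDerivAt).fderiv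
  exact (congrArg (fun L => L (EuclideanSpace.single i 1)) this).symm

lemma contDiff_gradient (hf : ContDiff ℝ ∞ f) : ContDiff ℝ ∞ (gradient f) := by
  rw [contDiff_euclidean]
  intro i
  simp only [gradient_apply_eq_partialDeriv]
  exact hf.partialDeriv_infty i

lemma lap_eq_sum (hf : ContDiff ℝ ∞ f) (x : EuclideanSpace ℝ (Fin n)) :
    lap f x = ∑ i, partialDeriv i (partialDeriv i f) x := by
  rw [lap, divg_eq_sum_partialDeriv ((contDiff_gradient hf).differentiable (by simp) x)]
  simp only [gradient_apply_eq_partialDeriv]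

/-- The integral of a partial derivative of a compactly supported `C¹` function vanishes. -/
lemma integral_partialDeriv_eq_zero (hf : ContDiff ℝ 1 f) (hc : HasCompactSupport f)
    (i : Fin n) : ∫ x, partialDeriv i f x = 0 := by
  have hd : Continuous (partialDeriv i f) := (hf.partialDeriv (k := 0) i (by simp)).continuous
  have hdc : HasCompactSupport (partialDeriv i f) := hc.fderiv_apply ℝ _
  have hint : Integrable (fun x => fderiv ℝ f x (EuclideanSpace.single i 1)) :=
    hd.integrable_of_hasCompactSupport hdc
  have := integral_mul_fderiv_eq_neg_fderiv_mul_of_integrable (μ := volume)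
    (f := fun _ : EuclideanSpace ℝ (Fin n) => (1 : ℝ)) (g := f) (v := EuclideanSpace.single i 1)
    (by simp) (by simpa using hint)
    (by simpa using hf.continuous.integrable_of_hasCompactSupport hc)
    (fun x _ => by fun_prop) (fun x _ => hf.differentiable (by simp) x)
  simpa [partialDeriv] using this

end PartialDeriv

/-- For a real matrix `a` and `w = |p|² > 0`, Cauchy–Schwarz for `tr (P (a P))`, with `P` the
orthogonal projection onto `p^⊥`. -/
lemma sq_trace_sub_le {n : ℕ} (a : Fin n → Fin n → ℝ) (p : Fin n → ℝ) {w : ℝ}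
    (hw : w = ∑ j, p j ^ 2) (hpos : 0 < w) :
    (∑ i, a i i - (∑ i, p i * ∑ j, a i j * p j) / w) ^ 2 ≤
      ((n : ℝ) - 1) * (∑ i, ∑ j, a i j ^ 2 - (∑ i, (∑ j, a i j * p j) ^ 2) / w) := by
  set q : Fin n → ℝ := fun i => ∑ j, a i j * p j with hq
  let P : Fin n × Fin n → ℝ := fun z => (if z.1 = z.2 then 1 else 0) - p z.1 * p z.2 / w
  let B : Fin n × Fin n → ℝ := fun z => a z.1 z.2 - q z.1 * p z.2 / w
  have hw0 := hpos.ne'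
  have e1 : ∑ z, P z * B z = ∑ i, a i i - (∑ i, p i * q i) / w := by
    rw [Fintype.sum_prod_type]
    have : ∀ i, ∑ j, P (i, j) * B (i, j) = a i i - p i * q i / w := by
      intro i
      have : ∀ j, P (i, j) * B (i, j) = (if i = j then a i j - q i * p j / w else 0)
          - p i / w * (a i j * p j) + p i * q i / w ^ 2 * p j ^ 2 := by
        intro j
        simp only [P, B]
        split_ifs <;> field_simp <;> ring
      simp only [this, Finset.sum_add_distrib, Finset.sum_sub_distrib, ← Finset.mul_sum, ← hw]
      simp only [Finset.sum_ite_eq, Finset.mem_univ, if_true]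
      change _ - p i / w * q i + _ = _
      field_simp
      ring
    simp only [this, Finset.sum_sub_distrib, Finset.sum_div]
  have e2 : ∑ z, P z ^ 2 = (n : ℝ) - 1 := by
    rw [Fintype.sum_prod_type]
    have : ∀ i, ∑ j, P (i, j) ^ 2 = 1 - p i ^ 2 / w := by
      intro i
      have : ∀ j, P (i, j) ^ 2 = (if i = j then 1 - 2 * (p i * p j / w) else 0)
          + p i ^ 2 / w ^ 2 * p j ^ 2 := by
        intro j
        simp only [P]
        split_ifs <;> field_simp <;> ring
      simp only [this, Finset.sum_add_distrib, ← Finset.mul_sum, ← hw]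
      simp only [Finset.sum_ite_eq, Finset.mem_univ, if_true]
      field_simp
      ring
    simp only [this, Finset.sum_sub_distrib, ← Finset.sum_div, ← hw]
    simp [hw0]
  have e3 : ∑ z, B z ^ 2 = ∑ i, ∑ j, a i j ^ 2 - (∑ i, q i ^ 2) / w := by
    rw [Fintype.sum_prod_type, Finset.sum_div, ← Finset.sum_sub_distrib]
    refine Finset.sum_congr rfl fun i _ => ?_
    have : ∀ j, B (i, j) ^ 2 = a i j ^ 2 - 2 * q i / w * (a i j * p j)
        + q i ^ 2 / w ^ 2 * p j ^ 2 := by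
      intro j
      simp only [B]
      field_simp
      ring
    simp only [this, Finset.sum_add_distrib, Finset.sum_sub_distrib, ← Finset.mul_sum, ← hw]
    change _ - 2 * q i / w * q i + _ = _
    field_simp
    ring
  have := Finset.sum_mul_sq_le_sq_mul_sq Finset.univ P B
  rwa [e1, e2, e3] at this

section MeanCurvature

variable {n : ℕ} {u : EuclideanSpace ℝ (Fin n) → ℝ} {x : EuclideanSpace ℝ (Fin n)}

lemma partialDeriv_norm_gradient (hu : ContDiff ℝ ∞ u) (hx : gradient u x ≠ 0) (i : Fin n) :
    ‖gradient u x‖ * partialDeriv i (fun y => ‖gradient u y‖) x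
      = ∑ j, partialDeriv i (partialDeriv j u) x * partialDeriv j u x := by
  have hN : DifferentiableAt ℝ (fun y => ‖gradient u y‖) x :=
    ((contDiff_gradient hu).differentiable (by simp) x).norm ℝ hx
  have hd : ∀ j, DifferentiableAt ℝ (partialDeriv j u) x := fun j =>
    (hu.partialDeriv_infty j).differentiable (by simp) x
  have h := partialDeriv_sq i hN
  simp only [norm_gradient_sq] at h
  rw [partialDeriv_sum _ _ fun j _ => (hd j).fun_pow 2] at h
  simp only [fun j => partialDeriv_sq i (hd j), ← Finset.mul_sum] at h
  rw [← mul_left_cancel₀ two_ne_zero h]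
  exact Finset.sum_congr rfl fun j _ => mul_comm _ _

lemma sq_meanCurv_mul_sq_norm_gradient_le (hn : 2 ≤ n) (hu : ContDiff ℝ ∞ u)
    (hx : gradient u x ≠ 0) :
    ((n : ℝ) - 1) * (meanCurv u x ^ 2 * ‖gradient u x‖ ^ 2) ≤
      ∑ i, ∑ j, partialDeriv i (partialDeriv j u) x ^ 2
        - (∑ i, (∑ j, partialDeriv i (partialDeriv j u) x * partialDeriv j u x) ^ 2)
          / ‖gradient u x‖ ^ 2 := by
  have hN0 : ‖gradient u x‖ ≠ 0 := norm_ne_zero_iff.2 hx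
  have hN : DifferentiableAt ℝ (fun y => ‖gradient u y‖) x :=
    ((contDiff_gradient hu).differentiable (by simp) x).norm ℝ hx
  have hn1 : (0 : ℝ) < (n : ℝ) - 1 := by
    have : (2 : ℝ) ≤ n := by exact_mod_cast hn
    linarith
  have hd : ∀ j, DifferentiableAt ℝ (partialDeriv j u) x := fun j =>
    (hu.partialDeriv_infty j).differentiable (by simp) x
  have hdiv : divg (fun y => ‖gradient u y‖⁻¹ • gradient u y) x * ‖gradient u x‖
      = ∑ i, partialDeriv i (partialDeriv i u) x
        - (∑ i, partialDeriv i u x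
            * ∑ j, partialDeriv i (partialDeriv j u) x * partialDeriv j u x)
          / ‖gradient u x‖ ^ 2 := by
    rw [divg_eq_sum_partialDeriv
      ((hN.fun_inv hN0).fun_smul ((contDiff_gradient hu).differentiable (by simp) x)),
      Finset.sum_mul, Finset.sum_div, ← Finset.sum_sub_distrib]
    refine Finset.sum_congr rfl fun i _ => ?_
    simp only [PiLp.smul_apply, smul_eq_mul, gradient_apply_eq_partialDeriv]
    rw [partialDeriv_mul i (hN.fun_inv hN0) (hd i),
      partialDeriv_comp i (f := fun y => ‖gradient u y‖) (φ := fun t => t⁻¹)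
        (differentiableAt_inv hN0) hN,
      ← partialDeriv_norm_gradient hu hx i]
    simp only [deriv_inv]
    field_simp
    ring
  have key := sq_trace_sub_le (fun i j => partialDeriv i (partialDeriv j u) x)
    (fun j => partialDeriv j u x) (norm_gradient_sq u x) (by positivity)
  rw [← hdiv] at key
  refine le_of_mul_le_mul_left ?_ hn1
  refine le_trans (le_of_eq ?_) key
  unfold meanCurv
  field_simp

/-- The function `H_u² |∇u|²` on `{∇u ≠ 0}`, extended by zero. -/
noncomputable def curvTerm (u : EuclideanSpace ℝ (Fin n) → ℝ) : EuclideanSpace ℝ (Fin n) → ℝ :=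
  {x | gradient u x ≠ 0}.indicator fun x => meanCurv u x ^ 2 * ‖gradient u x‖ ^ 2

/-- The squared Hilbert–Schmidt norm of the Hessian. -/
noncomputable def hessSq (u : EuclideanSpace ℝ (Fin n) → ℝ) (x : EuclideanSpace ℝ (Fin n)) : ℝ :=
  ∑ i, ∑ j, partialDeriv i (partialDeriv j u) x ^ 2

/-- The vector `D²u ∇u`. -/
noncomputable def hessGrad (u : EuclideanSpace ℝ (Fin n) → ℝ) (i : Fin n)
    (x : EuclideanSpace ℝ (Fin n)) : ℝ :=
  ∑ j, partialDeriv i (partialDeriv j u) x * partialDeriv j u x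

lemma hessSq_nonneg (u : EuclideanSpace ℝ (Fin n) → ℝ) (x : EuclideanSpace ℝ (Fin n)) :
    0 ≤ hessSq u x := by
  unfold hessSq
  positivity

lemma curvTerm_nonneg (u : EuclideanSpace ℝ (Fin n) → ℝ) (x : EuclideanSpace ℝ (Fin n)) :
    0 ≤ curvTerm u x :=
  Set.indicator_nonneg (fun _ _ => by positivity) x

lemma continuous_hessSq (hu : ContDiff ℝ ∞ u) : Continuous (hessSq u) := by
  unfold hessSq
  exact continuous_finsetSum _ fun i _ => continuous_finsetSum _ fun j _ =>
    (((hu.partialDeriv_infty j).partialDeriv_infty i).continuous).pow 2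

lemma contDiff_hessGrad (hu : ContDiff ℝ ∞ u) (i : Fin n) : ContDiff ℝ ∞ (hessGrad u i) := by
  unfold hessGrad
  exact ContDiff.sum fun j _ =>
    ((hu.partialDeriv_infty j).partialDeriv_infty i).mul (hu.partialDeriv_infty j)

lemma measurable_curvTerm (hu : ContDiff ℝ ∞ u) : Measurable (curvTerm u) := by
  have hg := (contDiff_gradient hu).continuous.measurable
  refine Measurable.indicator ?_ ((contDiff_gradient hu).continuous.measurable
    (measurableSet_singleton 0).compl)
  refine Measurable.mul (Measurable.pow_const ?_ 2) (hg.norm.pow_const 2)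
  unfold meanCurv divg
  refine Measurable.const_mul (Finset.measurable_sum _ fun i _ => ?_) _
  exact (EuclideanSpace.proj i : EuclideanSpace ℝ (Fin n) →L[ℝ] ℝ).continuous.measurable.comp
    (measurable_fderiv_apply_const ℝ _ _)

lemma curvTerm_add_le_hessSq (hn : 2 ≤ n) (hu : ContDiff ℝ ∞ u)
    (x : EuclideanSpace ℝ (Fin n)) {t : ℝ} (ht : 0 < t) :
    ((n : ℝ) - 1) * curvTerm u x + (∑ i, hessGrad u i x ^ 2) / (‖gradient u x‖ ^ 2 + t)
      ≤ hessSq u x := by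
  by_cases hx : gradient u x = 0
  · have h0 : ∀ j, partialDeriv j u x = 0 := fun j => by
      rw [← gradient_apply_eq_partialDeriv, hx]; rfl
    simpa [curvTerm, hx, hessGrad, h0] using hessSq_nonneg u x
  · have h := sq_meanCurv_mul_sq_norm_gradient_le hn hu hx
    have hpos : 0 < ‖gradient u x‖ ^ 2 := by positivity
    have hle : (∑ i, hessGrad u i x ^ 2) / (‖gradient u x‖ ^ 2 + t)
        ≤ (∑ i, hessGrad u i x ^ 2) / ‖gradient u x‖ ^ 2 := by
      gcongr
      linarith
    have hc : curvTerm u x = meanCurv u x ^ 2 * ‖gradient u x‖ ^ 2 :=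
      Set.indicator_of_mem (s := {x | gradient u x ≠ 0}) hx _
    unfold hessGrad at hle
    unfold hessGrad hessSq
    rw [hc]
    linarith

lemma ContDiff.continuous_norm_gradient {f : EuclideanSpace ℝ (Fin n) → ℝ}
    (hf : ContDiff ℝ 1 f) : Continuous fun x => ‖gradient f x‖ := by
  simp only [norm_gradient_eq_norm_fderiv]
  exact (hf.continuous_fderiv (by simp)).norm

lemma Continuous.integrableOn_of_isBounded {f : EuclideanSpace ℝ (Fin n) → ℝ}
    {Ω : Set (EuclideanSpace ℝ (Fin n))} (hf : Continuous f) (hΩ : IsBounded Ω) :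
    IntegrableOn f Ω :=
  (hf.continuousOn.integrableOn_compact hΩ.isCompact_closure).mono_set subset_closure

lemma integrableOn_curvTerm (hn : 2 ≤ n) (hu : ContDiff ℝ ∞ u)
    {Ω : Set (EuclideanSpace ℝ (Fin n))} (hΩ : IsBounded Ω) :
    IntegrableOn (curvTerm u) Ω := by
  refine ((continuous_hessSq hu).integrableOn_of_isBounded hΩ).mono'
    (measurable_curvTerm hu).aestronglyMeasurable (Eventually.of_forall fun x => ?_)
  rw [Real.norm_of_nonneg (curvTerm_nonneg u x)]
  have h := curvTerm_add_le_hessSq hn hu x one_pos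
  have h2 : 0 ≤ (∑ i, hessGrad u i x ^ 2) / (‖gradient u x‖ ^ 2 + 1) := by positivity
  have h3 : (2 : ℝ) ≤ n := by exact_mod_cast hn
  nlinarith [curvTerm_nonneg u x]

/-- Differentiating the equation: `∂ⱼ Δu = -g'(u) ∂ⱼu`. -/
lemma sum_partialDeriv_hess {Ω : Set (EuclideanSpace ℝ (Fin n))} (hΩo : IsOpen Ω) {g : ℝ → ℝ}
    (hg : ContDiff ℝ ∞ g) (hu : ContDiff ℝ ∞ u) (heq : ∀ x ∈ Ω, -lap u x = g (u x))
    (hx : x ∈ Ω) (j : Fin n) :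
    ∑ i, partialDeriv i (partialDeriv i (partialDeriv j u)) x
      = -(deriv g (u x) * partialDeriv j u x) := by
  have h2 : ∀ {f : EuclideanSpace ℝ (Fin n) → ℝ}, ContDiff ℝ ∞ f → ContDiff ℝ 2 f :=
    fun hf => by exact_mod_cast contDiff_infty.1 hf 2
  have hcomm : ∀ i, partialDeriv i (partialDeriv i (partialDeriv j u)) x
      = partialDeriv j (partialDeriv i (partialDeriv i u)) x := fun i => by
    rw [partialDeriv_comm (h2 hu) i j, partialDeriv_comm (h2 (hu.partialDeriv_infty i)) i j]
  simp only [hcomm]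
  rw [← partialDeriv_sum Finset.univ j fun i _ =>
    ((hu.partialDeriv_infty i).partialDeriv_infty i).differentiable (by simp) x,
    ← partialDeriv_comp j (hg.differentiable (by simp) _) (hu.differentiable (by simp) x)]
  have hev : (fun y => ∑ i, partialDeriv i (partialDeriv i u) y) =ᶠ[𝓝 x] fun y => -g (u y) := by
    filter_upwards [hΩo.mem_nhds hx] with y hy
    rw [← lap_eq_sum hu, ← heq y hy, neg_neg]
  unfold partialDeriv at hev ⊢
  rw [hev.fderiv_eq, fderiv_fun_neg]
  rfl

lemma sum_partialDeriv_sq_mul_hessGrad {Ω : Set (EuclideanSpace ℝ (Fin n))} (hΩo : IsOpen Ω)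
    {g : ℝ → ℝ} (hg : ContDiff ℝ ∞ g) (hu : ContDiff ℝ ∞ u)
    (heq : ∀ x ∈ Ω, -lap u x = g (u x)) (hx : x ∈ Ω) {φ : EuclideanSpace ℝ (Fin n) → ℝ}
    (hφ : ContDiff ℝ ∞ φ) :
    ∑ i, partialDeriv i (fun y => φ y ^ 2 * hessGrad u i y) x
      = φ x ^ 2 * (hessSq u x - deriv g (u x) * ‖gradient u x‖ ^ 2)
        + 2 * φ x * ∑ i, partialDeriv i φ x * hessGrad u i x := by
  have hφd : DifferentiableAt ℝ φ x := hφ.differentiable (by simp) x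
  have hd : ∀ j, DifferentiableAt ℝ (partialDeriv j u) x := fun j =>
    (hu.partialDeriv_infty j).differentiable (by simp) x
  have hd2 : ∀ i j, DifferentiableAt ℝ (partialDeriv i (partialDeriv j u)) x := fun i j =>
    ((hu.partialDeriv_infty j).partialDeriv_infty i).differentiable (by simp) x
  have hq : ∀ i, partialDeriv i (hessGrad u i) x = ∑ j, partialDeriv i (partialDeriv j u) x ^ 2
      + ∑ j, partialDeriv i (partialDeriv i (partialDeriv j u)) x * partialDeriv j u x := by
    intro i
    unfold hessGrad
    rw [partialDeriv_sum _ _ fun j _ => (hd2 i j).fun_mul (hd j), ← Finset.sum_add_distrib]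
    refine Finset.sum_congr rfl fun j _ => ?_
    rw [partialDeriv_mul i (hd2 i j) (hd j), sq]
  have hdiv : ∑ i, partialDeriv i (hessGrad u i) x
      = hessSq u x - deriv g (u x) * ‖gradient u x‖ ^ 2 := by
    simp only [hq, Finset.sum_add_distrib]
    rw [Finset.sum_comm (f := fun i j =>
      partialDeriv i (partialDeriv i (partialDeriv j u)) x * partialDeriv j u x)]
    simp only [← Finset.sum_mul, sum_partialDeriv_hess hΩo hg hu heq hx, norm_gradient_sq,
      Finset.mul_sum, hessSq, sub_eq_add_neg, ← Finset.sum_neg_distrib]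
    congr 1
    exact Finset.sum_congr rfl fun j _ => by ring
  have hterm : ∀ i, partialDeriv i (fun y => φ y ^ 2 * hessGrad u i y) x
      = φ x ^ 2 * partialDeriv i (hessGrad u i) x
        + 2 * φ x * (partialDeriv i φ x * hessGrad u i x) := by
    intro i
    rw [partialDeriv_mul i (hφd.fun_pow 2) ((contDiff_hessGrad hu i).differentiable (by simp) x),
      partialDeriv_sq i hφd]
    ring
  simp only [hterm, Finset.sum_add_distrib, ← Finset.mul_sum, hdiv]

lemma norm_gradient_sqrt_mul_sq (hu : ContDiff ℝ ∞ u) {φ : EuclideanSpace ℝ (Fin n) → ℝ}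
    (hφ : ContDiff ℝ ∞ φ) {t : ℝ} (ht : 0 < t) (x : EuclideanSpace ℝ (Fin n)) :
    ‖gradient (fun y => √(‖gradient u y‖ ^ 2 + t) * φ y) x‖ ^ 2
      = (‖gradient u x‖ ^ 2 + t) * ‖gradient φ x‖ ^ 2
        + 2 * φ x * (∑ i, partialDeriv i φ x * hessGrad u i x)
        + φ x ^ 2 * ((∑ i, hessGrad u i x ^ 2) / (‖gradient u x‖ ^ 2 + t)) := by
  have hd : ∀ j, DifferentiableAt ℝ (partialDeriv j u) x := fun j =>
    (hu.partialDeriv_infty j).differentiable (by simp) x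
  have hφd : DifferentiableAt ℝ φ x := hφ.differentiable (by simp) x
  set c : EuclideanSpace ℝ (Fin n) → ℝ := fun y => √(‖gradient u y‖ ^ 2 + t) with hc
  have hpos : ∀ y, 0 < ‖gradient u y‖ ^ 2 + t := fun y => by positivity
  have hcpos : 0 < c x := Real.sqrt_pos.2 (hpos x)
  have hcd : DifferentiableAt ℝ c x :=
    ((((contDiff_gradient hu).differentiable (by simp) x).norm_sq ℝ).add_const t).sqrt (hpos x).ne'
  have hcsq : ∀ y, c y ^ 2 = ‖gradient u y‖ ^ 2 + t := fun y => Real.sq_sqrt (hpos y).le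
  have hcq : ∀ i, c x * partialDeriv i c x = hessGrad u i x := by
    intro i
    have h := partialDeriv_sq i hcd
    simp only [hcsq, norm_gradient_sq] at h
    have h' : partialDeriv i (fun y => ∑ j, partialDeriv j u y ^ 2 + t) x
        = partialDeriv i (fun y => ∑ j, partialDeriv j u y ^ 2) x := by
      unfold partialDeriv
      rw [fderiv_add_const]
    rw [h', partialDeriv_sum _ _ fun j _ => (hd j).fun_pow 2] at h
    simp only [fun j => partialDeriv_sq i (hd j), ← Finset.mul_sum] at h
    rw [← mul_left_cancel₀ two_ne_zero h]
    exact Finset.sum_congr rfl fun j _ => mul_comm _ _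
  rw [norm_gradient_sq, norm_gradient_sq φ, ← hcsq, Finset.mul_sum, Finset.mul_sum, Finset.sum_div,
    Finset.mul_sum, ← Finset.sum_add_distrib, ← Finset.sum_add_distrib]
  refine Finset.sum_congr rfl fun i _ => ?_
  rw [partialDeriv_mul i hcd hφd, ← hcq]
  field_simp
  ring

lemma curvature_inequality_of_smooth (hn : 2 ≤ n) {Ω : Set (EuclideanSpace ℝ (Fin n))}
    (hΩo : IsOpen Ω) (hΩb : IsBounded Ω) {g : ℝ → ℝ} (hg : ContDiff ℝ ∞ g)
    (hu : ContDiff ℝ ∞ u) (heq : ∀ x ∈ Ω, -lap u x = g (u x)) (hstab : SemiStable Ω g u)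
    {φ : EuclideanSpace ℝ (Fin n) → ℝ} (hφ : ContDiff ℝ ∞ φ) (hφc : HasCompactSupport φ)
    (hφΩ : tsupport φ ⊆ Ω) :
    ((n : ℝ) - 1) * ∫ x in Ω, curvTerm u x * φ x ^ 2
      ≤ ∫ x in Ω, ‖gradient u x‖ ^ 2 * ‖gradient φ x‖ ^ 2 := by
  have hgu := (hu.of_le (by simp)).continuous_norm_gradient
  have hgφ := (hφ.of_le (by simp)).continuous_norm_gradient
  have hg' : Continuous fun x => deriv g (u x) :=
    (hg.continuous_deriv (by simp)).comp hu.continuous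
  have hiF : IntegrableOn (fun x => curvTerm u x * φ x ^ 2) Ω := by
    obtain ⟨M, hM⟩ := (hφc.comp_left (g := fun s : ℝ => s ^ 2) (by simp)).exists_bound_of_continuous
      ((continuous_pow 2).comp hφ.continuous)
    exact (integrableOn_curvTerm hn hu hΩb).mul_bdd (c := M)
      (hφ.continuous.pow 2).aestronglyMeasurable (Eventually.of_forall hM)
  have hiR : IntegrableOn (fun x => ‖gradient u x‖ ^ 2 * ‖gradient φ x‖ ^ 2) Ω :=
    ((hgu.pow 2).mul (hgφ.pow 2)).integrableOn_of_isBounded hΩb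
  have hiC : IntegrableOn (fun x => ‖gradient φ x‖ ^ 2 - deriv g (u x) * φ x ^ 2) Ω :=
    ((hgφ.pow 2).sub (hg'.mul (hφ.continuous.pow 2))).integrableOn_of_isBounded hΩb
  have hV : ∀ i, ContDiff ℝ ∞ fun y => φ y ^ 2 * hessGrad u i y := fun i =>
    (hφ.pow 2).mul (contDiff_hessGrad hu i)
  have hVi : ∀ i, IntegrableOn (partialDeriv i fun y => φ y ^ 2 * hessGrad u i y) Ω := fun i =>
    ((hV i).partialDeriv_infty i).continuous.integrableOn_of_isBounded hΩb
  have hφ0 : ∀ x ∉ Ω, x ∉ tsupport φ := fun x hx h => hx (hφΩ h)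
  have hV0 : ∫ x in Ω, ∑ i, partialDeriv i (fun y => φ y ^ 2 * hessGrad u i y) x = 0 := by
    rw [integral_finsetSum _ fun i _ => hVi i]
    refine Finset.sum_eq_zero fun i _ => ?_
    have hsub : tsupport (fun y => φ y ^ 2 * hessGrad u i y) ⊆ tsupport φ := by
      refine closure_mono fun x hx => ?_
      contrapose! hx
      simp_all
    rw [setIntegral_eq_integral_of_forall_compl_eq_zero]
    · exact integral_partialDeriv_eq_zero ((hV i).of_le (by exact_mod_cast le_top))
        (hφc.of_isClosed_subset (isClosed_tsupport _) hsub) i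
    · intro x hx
      have := image_eq_zero_of_notMem_tsupport
        fun h => hφ0 x hx (hsub (tsupport_fderiv_subset ℝ h))
      simp [partialDeriv, this]
  have key : ∀ t : ℝ, 0 < t → ((n : ℝ) - 1) * ∫ x in Ω, curvTerm u x * φ x ^ 2
      ≤ (∫ x in Ω, ‖gradient u x‖ ^ 2 * ‖gradient φ x‖ ^ 2)
        + t * ∫ x in Ω, (‖gradient φ x‖ ^ 2 - deriv g (u x) * φ x ^ 2) := by
    intro t ht
    have hξ : ContDiff ℝ 1 fun y => √(‖gradient u y‖ ^ 2 + t) * φ y := by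
      refine ContDiff.mul (ContDiff.sqrt ?_ fun y => by positivity)
        (hφ.of_le (by exact_mod_cast le_top))
      exact (((contDiff_gradient hu).of_le (by exact_mod_cast le_top)).norm_sq ℝ).add contDiff_const
    have hst := hstab _ hξ fun x hx => by
      rw [image_eq_zero_of_notMem_tsupport (f := φ) fun h => ?_, mul_zero]
      exact (hΩo.frontier_eq ▸ hx).2 (hφΩ h)
    have hξi : IntegrableOn (fun x => ‖gradient (fun y => √(‖gradient u y‖ ^ 2 + t) * φ y) x‖ ^ 2
        - deriv g (u x) * (√(‖gradient u x‖ ^ 2 + t) * φ x) ^ 2) Ω := by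
      refine Continuous.integrableOn_of_isBounded ?_ hΩb
      exact (hξ.continuous_norm_gradient.pow 2).sub (hg'.mul (hξ.continuous.pow 2))
    have hiRC : IntegrableOn (fun x => ‖gradient u x‖ ^ 2 * ‖gradient φ x‖ ^ 2
        + t * (‖gradient φ x‖ ^ 2 - deriv g (u x) * φ x ^ 2)) Ω := hiR.add (hiC.const_mul t)
    rw [← integral_const_mul, ← integral_const_mul, ← integral_add hiR (hiC.const_mul t),
      ← sub_nonneg, ← integral_sub hiRC (hiF.const_mul _)]
    have hsub := integral_sub hξi (integrable_finsetSum Finset.univ fun i _ => hVi i)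
    rw [hV0, sub_zero] at hsub
    refine (hst.trans_eq hsub.symm).trans (setIntegral_mono_on
      (hξi.sub (integrable_finsetSum Finset.univ fun i _ => hVi i))
      (hiRC.sub (hiF.const_mul _)) hΩo.measurableSet fun x hx => ?_)
    rw [sum_partialDeriv_sq_mul_hessGrad hΩo hg hu heq hx hφ, norm_gradient_sqrt_mul_sq hu hφ ht,
      mul_pow, Real.sq_sqrt (by positivity)]
    have h := mul_le_mul_of_nonneg_left (curvTerm_add_le_hessSq hn hu x ht) (sq_nonneg (φ x))
    linarith
  set C := ∫ x in Ω, (‖gradient φ x‖ ^ 2 - deriv g (u x) * φ x ^ 2)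
  refine ge_of_tendsto (x := 𝓝[>] (0 : ℝ)) (f := fun t => _ + t * C) ?_
    (eventually_nhdsWithin_of_forall key)
  refine tendsto_nhdsWithin_of_tendsto_nhds ?_
  simpa using (tendsto_const_nhds (x := ∫ x in Ω, ‖gradient u x‖ ^ 2 * ‖gradient φ x‖ ^ 2)).add
    ((tendsto_id (α := ℝ) (x := 𝓝 0)).mul_const C)

end MeanCurvature

section LipschitzApproximation

open scoped Convolution
open Metric

variable {E : Type*} [NormedAddCommGroup E] [NormedSpace ℝ E]

lemma norm_fderiv_le_of_abs_sub_le {f h : E → ℝ} {x : E} (hf : DifferentiableAt ℝ f x)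
    (hh : DifferentiableAt ℝ h x) (hfh : ∀ y, |f y - f x| ≤ |h y - h x|) :
    ‖fderiv ℝ f x‖ ≤ ‖fderiv ℝ h x‖ := by
  refine ContinuousLinearMap.opNorm_le_bound _ (norm_nonneg _) fun v => ?_
  refine le_trans ?_ ((fderiv ℝ h x).le_opNorm v)
  refine le_of_tendsto_of_tendsto'
    (hf.hasFDerivAt.hasLineDerivAt v).tendsto_slope_zero.norm
    (hh.hasFDerivAt.hasLineDerivAt v).tendsto_slope_zero.norm fun t => ?_
  rw [norm_smul, norm_smul]
  exact mul_le_mul_of_nonneg_left (hfh _) (norm_nonneg _)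

/-- Extension by zero of a function which is Lipschitz on the closure of an open set and vanishes
on its boundary. -/
lemma LipschitzOnWith.indicator_of_frontier_eq_zero {K : NNReal} {f : E → ℝ} {Ω : Set E}
    (hΩ : IsOpen Ω) (hf : LipschitzOnWith K f (closure Ω)) (h0 : ∀ x ∈ frontier Ω, f x = 0) :
    LipschitzWith K (Ω.indicator f) := by
  have hcl : ∀ x ∈ closure Ω, Ω.indicator f x = f x := by
    intro x hx
    by_cases hxΩ : x ∈ Ω
    · exact Set.indicator_of_mem hxΩ f
    · rw [Set.indicator_of_notMem hxΩ, h0 x (hΩ.frontier_eq ▸ ⟨hx, hxΩ⟩)]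
  have hmix : ∀ x ∈ Ω, ∀ y ∉ closure Ω, dist (Ω.indicator f x) (Ω.indicator f y)
      ≤ K * dist x y := by
    intro x hx y hy
    have hyΩ : y ∉ Ω := fun h => hy (subset_closure h)
    obtain ⟨z, hz, hzf⟩ : ∃ z ∈ segment ℝ x y, z ∈ frontier Ω := by
      by_contra! hcon
      obtain ⟨z, -, hz1, hz2⟩ := (convex_segment x y).isPreconnected Ω (closure Ω)ᶜ hΩ
        isClosed_closure.isOpen_compl
        (fun z hz => by
          by_contra hzz
          rw [Set.mem_union, not_or, Set.notMem_compl_iff] at hzz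
          exact hcon z hz (hΩ.frontier_eq ▸ ⟨hzz.2, hzz.1⟩))
        ⟨x, left_mem_segment ℝ x y, hx⟩ ⟨y, right_mem_segment ℝ x y, hy⟩
      exact hz2 (subset_closure hz1)
    have h1 := hf.dist_le_mul x (subset_closure hx) z (frontier_subset_closure hzf)
    have h2 := dist_add_dist_of_mem_segment hz
    rw [Set.indicator_of_mem hx, Set.indicator_of_notMem hyΩ, ← h0 z hzf]
    refine h1.trans (mul_le_mul_of_nonneg_left ?_ K.2)
    linarith [dist_nonneg (x := z) (y := y)]
  refine LipschitzWith.of_dist_le_mul fun x y => ?_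
  by_cases hx : x ∈ closure Ω <;> by_cases hy : y ∈ closure Ω
  · rw [hcl x hx, hcl y hy]
    exact hf.dist_le_mul x hx y hy
  · by_cases hxΩ : x ∈ Ω
    · exact hmix x hxΩ y hy
    · rw [Set.indicator_of_notMem hxΩ, Set.indicator_of_notMem fun h => hy (subset_closure h),
        dist_self]
      positivity
  · by_cases hyΩ : y ∈ Ω
    · rw [dist_comm, dist_comm x]
      exact hmix y hyΩ x hx
    · rw [Set.indicator_of_notMem hyΩ, Set.indicator_of_notMem fun h => hx (subset_closure h),
        dist_self]
      positivity
  · rw [Set.indicator_of_notMem fun h => hy (subset_closure h),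
      Set.indicator_of_notMem fun h => hx (subset_closure h), dist_self]
    positivity

/-- Soft thresholding, which moves every real number towards zero by at most `δ`. -/
noncomputable def softThreshold (δ s : ℝ) : ℝ := max (s - δ) 0 + min (s + δ) 0

lemma abs_softThreshold_sub_le {δ : ℝ} (hδ : 0 ≤ δ) (s t : ℝ) :
    |softThreshold δ s - softThreshold δ t| ≤ |s - t| := by
  unfold softThreshold
  rw [abs_le]
  constructor <;>
    rcases max_cases (s - δ) 0 with h1 | h1 <;> rcases max_cases (t - δ) 0 with h2 | h2 <;>
    rcases min_cases (s + δ) 0 with h3 | h3 <;> rcases min_cases (t + δ) 0 with h4 | h4 <;>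
    rcases abs_cases (s - t) with h5 | h5 <;> linarith

lemma abs_softThreshold_sub_self_le {δ : ℝ} (hδ : 0 ≤ δ) (s : ℝ) :
    |softThreshold δ s - s| ≤ δ := by
  unfold softThreshold
  rw [abs_le]
  constructor <;> rcases max_cases (s - δ) 0 with h1 | h1 <;>
    rcases min_cases (s + δ) 0 with h3 | h3 <;> linarith

lemma softThreshold_eq_zero {δ s : ℝ} (hs : |s| ≤ δ) : softThreshold δ s = 0 := by
  rw [abs_le] at hs
  rw [softThreshold, max_eq_right (by linarith), min_eq_right (by linarith), add_zero]

variable [FiniteDimensional ℝ E] [MeasurableSpace E] [BorelSpace E]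
  {μ : Measure E} [μ.IsAddHaarMeasure]

lemma LipschitzWith.hasFDerivAt_normed_convolution {K : NNReal} {f : E → ℝ}
    (hf : LipschitzWith K f) (φ : ContDiffBump (0 : E)) (x : E) :
    HasFDerivAt (φ.normed μ ⋆[ContinuousLinearMap.lsmul ℝ ℝ, μ] f)
      ((φ.normed μ ⋆[ContinuousLinearMap.lsmul ℝ ℝ, μ] (fderiv ℝ f)) x) x := by
  have hφc : Continuous (φ.normed μ) := φ.continuous_normed
  have hint : ∀ y, Continuous fun t => φ.normed μ t • f (y - t) := fun y =>
    hφc.smul (hf.continuous.comp (continuous_const.sub continuous_id))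
  refine (hasFDerivAt_integral_of_dominated_loc_of_lip (μ := μ)
    (F := fun y t => φ.normed μ t • f (y - t)) (F' := fun t => φ.normed μ t • fderiv ℝ f (x - t))
    (bound := fun t => φ.normed μ t * K) (s := Set.univ) Filter.univ_mem ?_ ?_ ?_ ?_ ?_ ?_).2
  · exact Eventually.of_forall fun y => (hint y).aestronglyMeasurable
  · exact (hint x).integrable_of_hasCompactSupport φ.hasCompactSupport_normed.smul_right
  · exact hφc.aestronglyMeasurable.smul
      ((measurable_fderiv ℝ f).comp (measurable_const.sub measurable_id)).aestronglyMeasurable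
  · refine Eventually.of_forall fun t => (LipschitzWith.of_dist_le_mul fun y z => ?_).lipschitzOnWith
    have h := hf.dist_le_mul (y - t) (z - t)
    rw [dist_sub_right] at h
    have h0 := φ.nonneg_normed (μ := μ) t
    rw [dist_smul₀, Real.norm_of_nonneg h0, Real.coe_nnabs, abs_of_nonneg (by positivity),
      mul_assoc]
    exact mul_le_mul_of_nonneg_left h h0
  · exact (φ.integrable_normed).mul_const _
  · have h := (Measure.measurePreserving_sub_left μ x).quasiMeasurePreserving.ae
      (hf.ae_differentiableAt (μ := μ))
    filter_upwards [h] with t ht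
    have hsub : HasFDerivAt (fun y => f (y - t)) (fderiv ℝ f (x - t)) x :=
      ht.hasFDerivAt.comp x ((hasFDerivAt_id x).sub_const t)
    exact hsub.const_smul (φ.normed μ t)

/-- A compactly supported Lipschitz function is approximated by smooth functions with uniformly
bounded gradients which converge almost everywhere. -/
lemma LipschitzWith.exists_smooth_approx {K : NNReal} {f : E → ℝ} (hf : LipschitzWith K f)
    (hfc : HasCompactSupport f) {Ω : Set E} (hΩ : IsOpen Ω) (hfΩ : tsupport f ⊆ Ω) :
    ∃ F : ℕ → E → ℝ, (∀ k, ContDiff ℝ ∞ (F k)) ∧ (∀ k, HasCompactSupport (F k)) ∧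
      (∀ᶠ k in atTop, tsupport (F k) ⊆ Ω) ∧ (∃ M, ∀ k x, |F k x| ≤ M) ∧
      (∀ x, Tendsto (fun k => F k x) atTop (𝓝 (f x))) ∧ (∀ k x, ‖fderiv ℝ (F k) x‖ ≤ K) ∧
      ∀ᵐ x ∂μ, Tendsto (fun k => fderiv ℝ (F k) x) atTop (𝓝 (fderiv ℝ f x)) := by
  let φ : ℕ → ContDiffBump (0 : E) := fun k =>
    ⟨1 / ((k : ℝ) + 1), 2 * (1 / ((k : ℝ) + 1)), by positivity, by
      have : 0 < 1 / ((k : ℝ) + 1) := by positivity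
      linarith⟩
  have hφr : ∀ k, (φ k).rOut = 2 * (1 / ((k : ℝ) + 1)) := fun _ => rfl
  have hφ0 : Tendsto (fun k => (φ k).rOut) atTop (𝓝 0) := by
    simp only [hφr]
    simpa using (tendsto_one_div_add_atTop_nhds_zero_nat (𝕜 := ℝ)).const_mul 2
  have hφ2 : ∀ k, (φ k).rOut ≤ 2 := by
    intro k
    rw [hφr]
    have : 1 / ((k : ℝ) + 1) ≤ 1 := by
      rw [div_le_one (by positivity)]
      linarith [Nat.cast_nonneg (α := ℝ) k]
    linarith
  have hfd : LocallyIntegrable (fderiv ℝ f) μ :=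
    (memLp_top_of_bound (measurable_fderiv ℝ f).aestronglyMeasurable K
      (Eventually.of_forall fun x => norm_fderiv_le_of_lipschitz ℝ hf)).locallyIntegrable le_top
  let F : ℕ → E → ℝ := fun k => (φ k).normed μ ⋆[ContinuousLinearMap.lsmul ℝ ℝ, μ] f
  have hder : ∀ k x, fderiv ℝ (F k) x
      = ((φ k).normed μ ⋆[ContinuousLinearMap.lsmul ℝ ℝ, μ] (fderiv ℝ f)) x := fun k x =>
    (hf.hasFDerivAt_normed_convolution (φ k) x).fderiv
  have hdist : ∀ k x, dist (F k x) (f x) ≤ K * (φ k).rOut := fun k x =>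
    (φ k).dist_normed_convolution_le hf.continuous.aestronglyMeasurable fun y hy =>
      (hf.dist_le_mul y x).trans (mul_le_mul_of_nonneg_left (mem_ball.1 hy).le K.2)
  have hsupp : ∀ k, tsupport (F k) ⊆ cthickening (φ k).rOut (tsupport f) := by
    intro k
    refine closure_minimal (fun x hx => ?_) isClosed_cthickening
    obtain ⟨a, ha, b, hb, rfl⟩ := Set.mem_add.1 (support_convolution_subset _ hx)
    rw [(φ k).support_normed_eq, mem_ball_zero_iff] at ha
    refine mem_cthickening_of_dist_le _ b _ _ (subset_tsupport f hb) ?_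
    simpa using ha.le
  refine ⟨F, fun k => ?_, fun k => ?_, ?_, ?_, fun x => ?_, fun k x => ?_, ?_⟩
  · exact (φ k).hasCompactSupport_normed.contDiff_convolution_left _ (φ k).contDiff_normed
      hf.continuous.locallyIntegrable
  · exact hfc.isCompact.cthickening.of_isClosed_subset (isClosed_tsupport _) (hsupp k)
  · obtain ⟨δ, hδ, hδΩ⟩ := hfc.isCompact.exists_cthickening_subset_open hΩ hfΩ
    filter_upwards [hφ0.eventually_le_const hδ] with k hk
    exact (hsupp k).trans ((cthickening_mono hk _).trans hδΩ)
  · obtain ⟨M, hM⟩ := hfc.exists_bound_of_continuous hf.continuous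
    refine ⟨M + K * 2, fun k x => ?_⟩
    have h1 := hdist k x
    have h2 := hM x
    have h3 : (K : ℝ) * (φ k).rOut ≤ K * 2 := mul_le_mul_of_nonneg_left (hφ2 k) K.2
    rw [Real.dist_eq] at h1
    rw [Real.norm_eq_abs] at h2
    have h4 := abs_add_le (F k x - f x) (f x)
    rw [sub_add_cancel] at h4
    linarith
  · rw [tendsto_iff_dist_tendsto_zero]
    refine squeeze_zero (fun _ => dist_nonneg) (fun k => hdist k x) ?_
    simpa using hφ0.const_mul (K : ℝ)
  · rw [hder]
    calc ‖((φ k).normed μ ⋆[ContinuousLinearMap.lsmul ℝ ℝ, μ] (fderiv ℝ f)) x‖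
        ≤ ∫ t, (φ k).normed μ t * K ∂μ := by
          refine norm_integral_le_of_norm_le ((φ k).integrable_normed.mul_const _)
            (Eventually.of_forall fun t => ?_)
          rw [ContinuousLinearMap.lsmul_apply, norm_smul, Real.norm_of_nonneg ((φ k).nonneg_normed t)]
          exact mul_le_mul_of_nonneg_left (norm_fderiv_le_of_lipschitz ℝ hf)
            ((φ k).nonneg_normed t)
      _ = K := by rw [integral_mul_const, (φ k).integral_normed, one_mul]
  · simp only [hder]
    refine ContDiffBump.ae_convolution_tendsto_right_of_locallyIntegrable (K := 2) hφ0
      (Eventually.of_forall fun k => le_rfl) hfd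

end LipschitzApproximation

section LipschitzTestFunctions

variable {n : ℕ} {u : EuclideanSpace ℝ (Fin n) → ℝ}

lemma tendsto_setIntegral_curvTerm_mul_sq (hn : 2 ≤ n) (hu : ContDiff ℝ ∞ u)
    {Ω : Set (EuclideanSpace ℝ (Fin n))} (hΩb : IsBounded Ω)
    {F : ℕ → EuclideanSpace ℝ (Fin n) → ℝ} {f : EuclideanSpace ℝ (Fin n) → ℝ} {M : ℝ}
    (hF : ∀ k, Continuous (F k)) (hM : ∀ k x, |F k x| ≤ M)
    (hlim : ∀ x, Tendsto (fun k => F k x) atTop (𝓝 (f x))) :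
    Tendsto (fun k => ∫ x in Ω, curvTerm u x * F k x ^ 2) atTop
      (𝓝 (∫ x in Ω, curvTerm u x * f x ^ 2)) := by
  refine tendsto_integral_of_dominated_convergence (fun x => curvTerm u x * M ^ 2)
    (fun k => ((measurable_curvTerm hu).mul ((hF k).measurable.pow_const 2)).aestronglyMeasurable)
    ((integrableOn_curvTerm hn hu hΩb).mul_const _) (fun k => Eventually.of_forall fun x => ?_)
    (Eventually.of_forall fun x => ((hlim x).pow 2).const_mul _)
  rw [Real.norm_of_nonneg (mul_nonneg (curvTerm_nonneg u x) (sq_nonneg _))]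
  exact mul_le_mul_of_nonneg_left (sq_le_sq' (neg_le_of_abs_le (hM k x)) (le_of_abs_le (hM k x)))
    (curvTerm_nonneg u x)

lemma curvature_inequality_of_hasCompactSupport (hn : 2 ≤ n)
    {Ω : Set (EuclideanSpace ℝ (Fin n))} (hΩo : IsOpen Ω) (hΩb : IsBounded Ω) {g : ℝ → ℝ}
    (hg : ContDiff ℝ ∞ g) (hu : ContDiff ℝ ∞ u) (heq : ∀ x ∈ Ω, -lap u x = g (u x))
    (hstab : SemiStable Ω g u) {K : NNReal} {f : EuclideanSpace ℝ (Fin n) → ℝ}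
    (hf : LipschitzWith K f) (hfc : HasCompactSupport f) (hfΩ : tsupport f ⊆ Ω) :
    ((n : ℝ) - 1) * ∫ x in Ω, curvTerm u x * f x ^ 2
      ≤ ∫ x in Ω, ‖gradient u x‖ ^ 2 * ‖gradient f x‖ ^ 2 := by
  obtain ⟨F, hFs, hFc, hFΩ, ⟨M, hM⟩, hlim, hFK, hder⟩ :=
    hf.exists_smooth_approx (μ := volume) hfc hΩo hfΩ
  have hgu := (hu.of_le (by simp) : ContDiff ℝ 1 u).continuous_norm_gradient
  have hR : Tendsto (fun k => ∫ x in Ω, ‖gradient u x‖ ^ 2 * ‖gradient (F k) x‖ ^ 2) atTop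
      (𝓝 (∫ x in Ω, ‖gradient u x‖ ^ 2 * ‖gradient f x‖ ^ 2)) := by
    refine tendsto_integral_of_dominated_convergence (fun x => ‖gradient u x‖ ^ 2 * (K : ℝ) ^ 2)
      (fun k => ((hgu.pow 2).mul
        (((hFs k).of_le (by simp)).continuous_norm_gradient.pow 2)).aestronglyMeasurable)
      (((hgu.pow 2).integrableOn_of_isBounded hΩb).mul_const _)
      (fun k => Eventually.of_forall fun x => ?_) ?_
    · rw [Real.norm_of_nonneg (by positivity), norm_gradient_eq_norm_fderiv (F k)]
      have := hFK k x
      gcongr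
    · filter_upwards [ae_restrict_of_ae hder] with x hx
      simp only [norm_gradient_eq_norm_fderiv]
      exact (hx.norm.pow 2).const_mul _
  refine le_of_tendsto_of_tendsto ((tendsto_setIntegral_curvTerm_mul_sq hn hu hΩb
    (fun k => (hFs k).continuous) hM hlim).const_mul _) hR ?_
  filter_upwards [hFΩ] with k hk
  exact curvature_inequality_of_smooth hn hΩo hΩb hg hu heq hstab (hFs k) (hFc k) hk

lemma curvature_inequality_of_lipschitzWith (hn : 2 ≤ n)
    {Ω : Set (EuclideanSpace ℝ (Fin n))} (hΩo : IsOpen Ω) (hΩb : IsBounded Ω) {g : ℝ → ℝ}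
    (hg : ContDiff ℝ ∞ g) (hu : ContDiff ℝ ∞ u) (heq : ∀ x ∈ Ω, -lap u x = g (u x))
    (hstab : SemiStable Ω g u) {K : NNReal} {f : EuclideanSpace ℝ (Fin n) → ℝ}
    (hf : LipschitzWith K f) (hf0 : ∀ x ∉ Ω, f x = 0) :
    ((n : ℝ) - 1) * ∫ x in Ω, curvTerm u x * f x ^ 2
      ≤ ∫ x in Ω, ‖gradient u x‖ ^ 2 * ‖gradient f x‖ ^ 2 := by
  have hfc : HasCompactSupport f := by
    refine hΩb.isCompact_closure.of_isClosed_subset (isClosed_tsupport f)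
      (closure_mono fun x hx => ?_)
    by_contra hxΩ
    exact hx (hf0 x hxΩ)
  obtain ⟨M, hM⟩ := hfc.exists_bound_of_continuous hf.continuous
  have hgu := (hu.of_le (by simp) : ContDiff ℝ 1 u).continuous_norm_gradient
  have hgm : ∀ h : EuclideanSpace ℝ (Fin n) → ℝ, Measurable fun x => ‖gradient h x‖ := fun h => by
    simpa only [norm_gradient_eq_norm_fderiv] using (measurable_fderiv ℝ h).norm
  let δ : ℕ → ℝ := fun k => 1 / ((k : ℝ) + 1)
  have hδ : ∀ k, 0 < δ k := fun k => by positivity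
  let F : ℕ → EuclideanSpace ℝ (Fin n) → ℝ := fun k x => softThreshold (δ k) (f x)
  have hcontr : ∀ k x y, |F k x - F k y| ≤ |f x - f y| := fun k x y =>
    abs_softThreshold_sub_le (hδ k).le _ _
  have hF : ∀ k, LipschitzWith K (F k) := fun k =>
    LipschitzWith.of_dist_le_mul fun x y => (hcontr k x y).trans (hf.dist_le_mul x y)
  have hFbd : ∀ k x, |F k x| ≤ M := by
    intro k x
    have h := abs_softThreshold_sub_le (hδ k).le (f x) 0
    rw [softThreshold_eq_zero (s := 0) (by simpa using (hδ k).le), sub_zero, sub_zero] at h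
    exact h.trans (hM x)
  have hlim : ∀ x, Tendsto (fun k => F k x) atTop (𝓝 (f x)) := by
    intro x
    rw [tendsto_iff_dist_tendsto_zero]
    exact squeeze_zero (fun _ => dist_nonneg)
      (fun k => abs_softThreshold_sub_self_le (hδ k).le (f x))
      tendsto_one_div_add_atTop_nhds_zero_nat
  have hFΩ : ∀ k, tsupport (F k) ⊆ {x | δ k ≤ |f x|} := by
    intro k
    refine closure_minimal (fun x hx => ?_) (isClosed_le continuous_const hf.continuous.abs)
    by_contra hlt
    exact hx (softThreshold_eq_zero (not_le.1 hlt).le)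
  have hsub : ∀ k, {x | δ k ≤ |f x|} ⊆ Ω := by
    intro k x hx
    by_contra hxΩ
    rw [Set.mem_ofPred_eq, hf0 x hxΩ, abs_zero] at hx
    exact (hδ k).not_ge hx
  refine le_of_tendsto' ((tendsto_setIntegral_curvTerm_mul_sq hn hu hΩb
    (fun k => (hF k).continuous) hFbd hlim).const_mul _) fun k => ?_
  have hFc : HasCompactSupport (F k) :=
    hΩb.isCompact_closure.of_isClosed_subset (isClosed_tsupport _)
      (((hFΩ k).trans (hsub k)).trans subset_closure)
  refine (curvature_inequality_of_hasCompactSupport hn hΩo hΩb hg hu heq hstab (hF k) hFc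
    ((hFΩ k).trans (hsub k))).trans ?_
  have hint : ∀ h : EuclideanSpace ℝ (Fin n) → ℝ, LipschitzWith K h →
      IntegrableOn (fun x => ‖gradient u x‖ ^ 2 * ‖gradient h x‖ ^ 2) Ω := by
    intro h hh
    refine (((hgu.pow 2).integrableOn_of_isBounded hΩb).mul_const ((K : ℝ) ^ 2)).mono'
      (((hgm u).pow_const 2).mul ((hgm h).pow_const 2)).aestronglyMeasurable
      (Eventually.of_forall fun x => ?_)
    rw [Real.norm_of_nonneg (by positivity), norm_gradient_eq_norm_fderiv h]
    have : ‖fderiv ℝ h x‖ ≤ K := norm_fderiv_le_of_lipschitz ℝ hh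
    change _ ≤ ‖gradient u x‖ ^ 2 * (K : ℝ) ^ 2
    gcongr
  refine integral_mono_ae (hint _ (hF k)) (hint _ hf) ?_
  filter_upwards [ae_restrict_of_ae hf.ae_differentiableAt,
    ae_restrict_of_ae (hF k).ae_differentiableAt] with x hx hFx
  have h : ‖gradient (F k) x‖ ≤ ‖gradient f x‖ := by
    simpa only [norm_gradient_eq_norm_fderiv] using
      norm_fderiv_le_of_abs_sub_le hFx hx fun y => hcontr k y x
  change ‖gradient u x‖ ^ 2 * ‖gradient (F k) x‖ ^ 2 ≤ ‖gradient u x‖ ^ 2 * ‖gradient f x‖ ^ 2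
  gcongr

end LipschitzTestFunctions

/-- The stability inequality with test function `ξ = |∇u| η` (inequality (1.3)/(3.3)):
for every Lipschitz `η` on `Ω̄` vanishing on `∂Ω`,
`(n-1) ∫_{Ω∩{|∇u|>0}} H_u² |∇u|² η² dx ≤ ∫_Ω |∇u|² |∇η|² dx`. -/
theorem stmt_8 (n : ℕ) (hn : 2 ≤ n)
    (Ω : Set (EuclideanSpace ℝ (Fin n))) (hΩo : IsOpen Ω) (hΩb : IsBounded Ω)
    (g : ℝ → ℝ) (hg : ContDiff ℝ (⊤ : ℕ∞) g)
    (u : EuclideanSpace ℝ (Fin n) → ℝ) (hu : ContDiff ℝ (⊤ : ℕ∞) u)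
    (heq : ∀ x ∈ Ω, -lap u x = g (u x))
    (hbc : ∀ x ∈ frontier Ω, u x = 0)
    (hstab : SemiStable Ω g u) :
    ∀ (K : NNReal) (η : EuclideanSpace ℝ (Fin n) → ℝ),
      LipschitzOnWith K η (closure Ω) → (∀ x ∈ frontier Ω, η x = 0) →
      ((n : ℝ) - 1) *
          ∫ x in Ω ∩ {x | gradient u x ≠ 0},
            meanCurv u x ^ 2 * ‖gradient u x‖ ^ 2 * η x ^ 2 ≤
        ∫ x in Ω, ‖gradient u x‖ ^ 2 * ‖gradient η x‖ ^ 2 := by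
  intro K η hη hη0
  have hmeas : MeasurableSet {x | gradient u x ≠ 0} :=
    (contDiff_gradient hu).continuous.measurable (measurableSet_singleton 0).compl
  have hmain := curvature_inequality_of_lipschitzWith hn hΩo hΩb hg hu heq hstab
    (hη.indicator_of_frontier_eq_zero hΩo hη0) fun x hx => Set.indicator_of_notMem hx η
  have hL : ∫ x in Ω, curvTerm u x * Ω.indicator η x ^ 2
      = ∫ x in Ω ∩ {x | gradient u x ≠ 0},
          meanCurv u x ^ 2 * ‖gradient u x‖ ^ 2 * η x ^ 2 := by
    rw [← setIntegral_indicator hmeas]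
    refine setIntegral_congr_fun hΩo.measurableSet fun x hx => ?_
    by_cases h : gradient u x = 0 <;> simp [curvTerm, hx, h]
  have hR : ∫ x in Ω, ‖gradient u x‖ ^ 2 * ‖gradient (Ω.indicator η) x‖ ^ 2
      = ∫ x in Ω, ‖gradient u x‖ ^ 2 * ‖gradient η x‖ ^ 2 := by
    refine setIntegral_congr_fun hΩo.measurableSet fun x hx => ?_
    have hev : Ω.indicator η =ᶠ[𝓝 x] η := by
      filter_upwards [hΩo.mem_nhds hx] with y hy
      exact Set.indicator_of_mem hy η
    simp only [norm_gradient_eq_norm_fderiv, hev.fderiv_eq]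
  rwa [hL, hR] at hmain
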